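/- On a probability space, let X₁, X₂, … be nonnegative random variables with common survival function P(Xᵢ > x) = x^{-α} l(x) for all x > 0, where α ∈ (0,1) and l is slowly varying at infinity. Suppose Condition A(1) and Condition A(2) hold. Let V_n := M_{n,2} − M_{n,1}² be the sample variance. Then log V_n / log M_{n,1} →p (2−α)/(1−α) as n → ∞. -/

import Mathlib

open MeasureTheory Filter

noncomputable section

/-- `l` is slowly varying at infinity: for every `lam > 0`, `l(lam*x)/l(x) → 1` as `x → ∞`. -/
def SlowlyVarying (l : ℝ → ℝ) : Prop :=
  ∀ lam : ℝ, 0 < lam → Tendsto (fun x => l (lam * x) / l x) atTop (nhds 1)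

/-- Covariance `Cov(U,V) = E[UV] - E[U]E[V]`. -/
def cov {Ω : Type*} [MeasurableSpace Ω] (μ : Measure Ω) (U V : Ω → ℝ) : ℝ :=
  (∫ ω, U ω * V ω ∂μ) - (∫ ω, U ω ∂μ) * (∫ ω, V ω ∂μ)

/-- Truncation `X·1(X < t)`. -/
def trunc {Ω : Type*} (X : Ω → ℝ) (t : ℝ) : Ω → ℝ :=
  fun ω => if X ω < t then X ω else 0

/-- Sum of covariances of `p`-th powers of the variables truncated at `v n`,
over distinct pairs of indices among the first `n`. -/
def covSum {Ω : Type*} [MeasurableSpace Ω] (μ : Measure Ω) (X : ℕ → Ω → ℝ)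
    (v : ℕ → ℝ) (p : ℝ) (n : ℕ) : ℝ :=
  ∑ i ∈ Finset.range n, ∑ j ∈ Finset.range n,
    if i = j then 0
    else cov μ (fun ω => trunc (X i) (v n) ω ^ p) (fun ω => trunc (X j) (v n) ω ^ p)

/-- Condition A(p). -/
def ConditionA {Ω : Type*} [MeasurableSpace Ω] (μ : Measure Ω) (X : ℕ → Ω → ℝ)
    (v c : ℕ → ℝ) (p : ℝ) : Prop :=
  Tendsto (fun n => covSum μ X v p n / (v n ^ (2 * p) * c n ^ 2)) atTop (nhds 0)

/-- `p`-th sample moment `M_{n,p}`. -/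
def sampleMoment {Ω : Type*} (X : ℕ → Ω → ℝ) (p : ℝ) (n : ℕ) (ω : Ω) : ℝ :=
  (n : ℝ)⁻¹ * ∑ i ∈ Finset.range n, X i ω ^ p

/-- `Y_n = O_p(r_n)`. -/
def IsOp {Ω : Type*} [MeasurableSpace Ω] (μ : Measure Ω) (Y : ℕ → Ω → ℝ) (r : ℕ → ℝ) : Prop :=
  ∀ ε : ℝ, 0 < ε → ∃ C : ℝ, 0 < C ∧
    ∀ᶠ n in atTop, (μ {ω | C * r n < |Y n ω|}).toReal < ε

/-- Convergence in probability to a constant. -/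
def TendstoInProbability {Ω : Type*} [MeasurableSpace Ω] (μ : Measure Ω)
    (Y : ℕ → Ω → ℝ) (a : ℝ) : Prop :=
  ∀ ε : ℝ, 0 < ε → Tendsto (fun n => (μ {ω | ε < |Y n ω - a|}).toReal) atTop (nhds 0)

lemma dyadic_bound (H : ℝ → ℝ) (x0 K : ℝ) (hx0 : 0 < x0)
    (h2 : ∀ x, x0 ≤ x → H (2 * x) ≤ H x)
    (hb : ∀ x, x0 ≤ x → x ≤ 2 * x0 → H x ≤ K) : ∀ x, x0 ≤ x → H x ≤ K := by
  have key : ∀ k : ℕ, ∀ x, x0 ≤ x → x ≤ 2 ^ (k + 1) * x0 → H x ≤ K := by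
    intro k
    induction k with
    | zero => intro x hx hx'; exact hb x hx (by simpa using hx')
    | succ k ih =>
      intro x hx hx'
      by_cases h : x ≤ 2 * x0
      · exact hb x hx h
      · push Not at h
        have h1 : x0 ≤ x / 2 := by linarith
        have h3 := h2 (x / 2) h1
        have h4 : 2 * (x / 2) = x := by ring
        rw [h4] at h3
        refine h3.trans (ih _ h1 ?_)
        rw [pow_succ] at hx'
        linarith
  intro x hx
  obtain ⟨k, hk⟩ := pow_unbounded_of_one_lt (x / x0) (one_lt_two (α := ℝ))
  refine key k x hx ?_
  rw [div_lt_iff₀ hx0] at hk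
  rw [pow_succ]
  nlinarith [pow_pos (zero_lt_two (α := ℝ)) k]

lemma potter_upper (G : ℝ → ℝ) (hpos : ∀ x, 0 < x → 0 < G x)
    (hanti : ∀ x y, 0 < x → x ≤ y → G y ≤ G x) (α : ℝ)
    (hG : Tendsto (fun x => G (2 * x) / G x) atTop (nhds ((2:ℝ) ^ (-α))))
    (b : ℝ) (hb0 : 0 ≤ b) (hb : b < α) :
    ∃ x0 K : ℝ, 0 < x0 ∧ 0 < K ∧ ∀ x, x0 ≤ x → G x ≤ K * x ^ (-b) := by
  have h1 : ∀ᶠ x in atTop, G (2 * x) / G x < (2:ℝ) ^ (-b) :=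
    hG.eventually_lt_const (Real.rpow_lt_rpow_of_exponent_lt one_lt_two (by linarith))
  obtain ⟨x1, hx1⟩ := eventually_atTop.1 h1
  set x0 := max x1 1
  have hx0 : 0 < x0 := lt_of_lt_of_le one_pos (le_max_right _ _)
  refine ⟨x0, (2 * x0) ^ b * G x0, hx0, by have := hpos x0 hx0; positivity, ?_⟩
  have := dyadic_bound (fun x => x ^ b * G x) x0 ((2 * x0) ^ b * G x0) hx0 ?_ ?_
  · intro x hx
    have hxp : 0 < x := hx0.trans_le hx
    have h3 := this x hx
    rw [Real.rpow_neg hxp.le, ← div_eq_mul_inv, le_div_iff₀ (by positivity)]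
    linarith
  · intro x hx
    have hxp : 0 < x := hx0.trans_le hx
    have h3 := hx1 x ((le_max_left _ _).trans hx)
    rw [div_lt_iff₀ (hpos x hxp)] at h3
    rw [Real.mul_rpow (by norm_num) hxp.le]
    calc (2:ℝ) ^ b * x ^ b * G (2 * x) ≤ (2:ℝ) ^ b * x ^ b * (2 ^ (-b) * G x) := by gcongr
      _ = ((2:ℝ) ^ b * 2 ^ (-b)) * (x ^ b * G x) := by ring
      _ = _ := by rw [← Real.rpow_add (by norm_num)]; simp
  · intro x hx hx'
    have hxp : 0 < x := hx0.trans_le hx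
    have := (hpos x hxp).le
    gcongr
    exact hanti _ _ hx0 hx

lemma potter_lower (G : ℝ → ℝ) (hpos : ∀ x, 0 < x → 0 < G x)
    (hanti : ∀ x y, 0 < x → x ≤ y → G y ≤ G x) (α : ℝ)
    (hG : Tendsto (fun x => G (2 * x) / G x) atTop (nhds ((2:ℝ) ^ (-α))))
    (b : ℝ) (hb0 : 0 ≤ b) (hb : α < b) :
    ∃ x0 K : ℝ, 0 < x0 ∧ 0 < K ∧ ∀ x, x0 ≤ x → K * x ^ (-b) ≤ G x := by
  have h1 : ∀ᶠ x in atTop, (2:ℝ) ^ (-b) < G (2 * x) / G x :=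
    hG.eventually_const_lt (Real.rpow_lt_rpow_of_exponent_lt one_lt_two (by linarith))
  obtain ⟨x1, hx1⟩ := eventually_atTop.1 h1
  set x0 := max x1 1
  have hx0 : 0 < x0 := lt_of_lt_of_le one_pos (le_max_right _ _)
  refine ⟨x0, x0 ^ b * G (2 * x0), hx0, by have := hpos (2 * x0) (by positivity); positivity, ?_⟩
  have := dyadic_bound (fun x => -(x ^ b * G x)) x0 (-(x0 ^ b * G (2 * x0))) hx0 ?_ ?_
  · intro x hx
    have hxp : 0 < x := hx0.trans_le hx
    have h3 := this x hx
    rw [Real.rpow_neg hxp.le, ← div_eq_mul_inv, div_le_iff₀ (by positivity)]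
    linarith
  · intro x hx
    have hxp : 0 < x := hx0.trans_le hx
    have h3 := hx1 x ((le_max_left _ _).trans hx)
    rw [lt_div_iff₀ (hpos x hxp)] at h3
    rw [Real.mul_rpow (by norm_num) hxp.le, neg_le_neg_iff]
    calc x ^ b * G x = ((2:ℝ) ^ b * 2 ^ (-b)) * (x ^ b * G x) := by
          rw [← Real.rpow_add (by norm_num)]; simp
      _ = (2:ℝ) ^ b * x ^ b * (2 ^ (-b) * G x) := by ring
      _ ≤ (2:ℝ) ^ b * x ^ b * G (2 * x) := by gcongr
  · intro x hx hx'
    have hxp : 0 < x := hx0.trans_le hx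
    have := (hpos (2 * x0) (by positivity)).le
    rw [neg_le_neg_iff]
    gcongr
    exact hanti _ _ hxp hx'

lemma sum_rpow_le_sum_rpow {ι : Type*} (s : Finset ι) (a : ι → ℝ) (ha : ∀ i, 0 ≤ a i)
    {r : ℝ} (hr : 1 ≤ r) : ∑ i ∈ s, a i ^ r ≤ (∑ i ∈ s, a i) ^ r := by
  classical
  induction s using Finset.induction_on with
  | empty => simp [Real.zero_rpow (by linarith : r ≠ 0)]
  | insert i s hi ih =>
    rw [Finset.sum_insert hi, Finset.sum_insert hi]
    have h := NNReal.add_rpow_le_rpow_add (⟨a i, ha i⟩ : NNReal)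
      ⟨∑ i ∈ s, a i, Finset.sum_nonneg fun i _ => ha i⟩ hr
    have h' : a i ^ r + (∑ i ∈ s, a i) ^ r ≤ (a i + ∑ i ∈ s, a i) ^ r := by exact_mod_cast h
    linarith

/-- finite moments, uniformly bounded -/
lemma moment_bound {Ω : Type*} [MeasurableSpace Ω] (μ : Measure Ω) [IsProbabilityMeasure μ]
    (X : ℕ → Ω → ℝ) (hXmeas : ∀ i, Measurable (X i)) (hXnn : ∀ i ω, 0 ≤ X i ω)
    (G : ℝ → ℝ) (hsurv : ∀ i, ∀ x : ℝ, 0 < x → (μ {ω | x < X i ω}).toReal = G x)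
    (b x0 K : ℝ) (hx0 : 0 < x0) (hG : ∀ x, x0 ≤ x → G x ≤ K * x ^ (-b))
    (q : ℝ) (hq : 0 < q) (hqb : q < b) :
    ∃ B : ℝ, ∀ i, Integrable (fun ω => X i ω ^ q) μ ∧ ∫ ω, X i ω ^ q ∂μ ≤ B := by
  set I : ENNReal := ENNReal.ofReal q * ((∫⁻ t in Set.Ioo 0 x0, ENNReal.ofReal (t ^ (q - 1))) +
    ∫⁻ t in Set.Ici x0, ENNReal.ofReal (K * t ^ (q - 1 - b))) with hI
  have hIfin : I ≠ ⊤ := by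
    refine ENNReal.mul_ne_top ENNReal.ofReal_ne_top (ENNReal.add_ne_top.2 ⟨?_, ?_⟩)
    · exact ((intervalIntegral.integrableOn_Ioo_rpow_iff hx0).2 (by linarith)).lintegral_lt_top.ne
    · have : IntegrableOn (fun t : ℝ => K * t ^ (q - 1 - b)) (Set.Ici x0) := by
        rw [integrableOn_Ici_iff_integrableOn_Ioi]
        exact (integrableOn_Ioi_rpow_of_lt (by linarith) hx0).const_mul K
      exact this.lintegral_lt_top.ne
  have hle : ∀ i, ∫⁻ ω, ENNReal.ofReal (X i ω ^ q) ∂μ ≤ I := by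
    intro i
    rw [lintegral_rpow_eq_lintegral_meas_lt_mul μ (ae_of_all _ (hXnn i))
      (hXmeas i).aemeasurable hq, hI]
    gcongr
    rw [← Set.Ioo_union_Ici_eq_Ioi hx0, lintegral_union measurableSet_Ici
      (by rw [Set.disjoint_left]; rintro x ⟨_, h⟩ h'; exact absurd h (not_lt.2 h'))]
    refine add_le_add ?_ ?_
    · refine lintegral_mono fun t => ?_
      exact (mul_le_mul_left (prob_le_one) _).trans (one_mul _).le
    · refine setLIntegral_mono' measurableSet_Ici fun t ht => ?_
      have htp : 0 < t := hx0.trans_le ht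
      rw [← ENNReal.ofReal_toReal (measure_ne_top μ {a | t < X i a}), hsurv i t htp,
        ← ENNReal.ofReal_mul' (by positivity)]
      apply ENNReal.ofReal_le_ofReal
      calc G t * t ^ (q - 1) ≤ (K * t ^ (-b)) * t ^ (q - 1) := by gcongr; exact hG t ht
        _ = K * t ^ (q - 1 - b) := by
          rw [mul_assoc, ← Real.rpow_add htp]; ring_nf
  refine ⟨I.toReal, fun i => ?_⟩
  have hnn : ∀ ω, 0 ≤ X i ω ^ q := fun ω => Real.rpow_nonneg (hXnn i ω) _
  have hm : Measurable (fun ω => X i ω ^ q) := (hXmeas i).pow_const q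
  constructor
  · refine ⟨hm.aestronglyMeasurable, ?_⟩
    rw [hasFiniteIntegral_iff_ofReal (ae_of_all _ hnn)]
    exact lt_of_le_of_lt (hle i) hIfin.lt_top
  · rw [integral_eq_lintegral_of_nonneg_ae (ae_of_all _ hnn) hm.aestronglyMeasurable]
    exact ENNReal.toReal_mono hIfin (hle i)

lemma upper_whp {Ω : Type*} [MeasurableSpace Ω] (μ : Measure Ω) [IsProbabilityMeasure μ]
    (X : ℕ → Ω → ℝ) (hXmeas : ∀ i, Measurable (X i)) (hXnn : ∀ i ω, 0 ≤ X i ω)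
    (G : ℝ → ℝ) (hsurv : ∀ i, ∀ x : ℝ, 0 < x → (μ {ω | x < X i ω}).toReal = G x)
    (hpos : ∀ x, 0 < x → 0 < G x)
    (hanti : ∀ x y, 0 < x → x ≤ y → G y ≤ G x) (α : ℝ) (hα : 0 < α)
    (hG : Tendsto (fun x => G (2 * x) / G x) atTop (nhds ((2:ℝ) ^ (-α))))
    (p : ℝ) (hp : α < p) (θ : ℝ) (hθ : p / α < θ) :
    Tendsto (fun n : ℕ => μ.real {ω | (n:ℝ) ^ θ < ∑ i ∈ Finset.range n, X i ω ^ p})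
      atTop (nhds 0) := by
  have hp0 : 0 < p := hα.trans hp
  have hθ0 : 0 < θ := (div_pos hp0 hα).trans hθ
  have h1 : p / θ < α := by
    rw [div_lt_iff₀ hα] at hθ; rw [div_lt_iff₀ hθ0]; linarith
  obtain ⟨q, hq1, hq2⟩ := exists_between h1
  have hq0 : 0 < q := (div_pos hp0 hθ0).trans hq1
  obtain ⟨b, hb1, hb2⟩ := exists_between hq2
  obtain ⟨x0, K, hx0, hK, hGK⟩ := potter_upper G hpos hanti α hG b (hq0.trans hb1).le hb2
  obtain ⟨B, hB⟩ := moment_bound μ X hXmeas hXnn G hsurv b x0 K hx0 hGK q hq0 hb1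
  have hr : 1 ≤ p / q := by rw [le_div_iff₀ hq0]; linarith
  have hexp : 1 - θ * q / p < 0 := by
    rw [div_lt_iff₀ hθ0] at hq1
    rw [sub_neg, lt_div_iff₀ hp0]; linarith
  have hlim : Tendsto (fun n : ℕ => B * (n:ℝ) ^ (1 - θ * q / p)) atTop (nhds 0) := by
    have := (tendsto_rpow_neg_atTop (y := -(1 - θ * q / p)) (by linarith)).comp
      tendsto_natCast_atTop_atTop
    simpa using this.const_mul B
  refine squeeze_zero' (Eventually.of_forall fun n => measureReal_nonneg) ?_ hlim
  filter_upwards [eventually_gt_atTop 0] with n hn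
  have hn' : (0:ℝ) < n := by exact_mod_cast hn
  have hT0 : ∀ ω, 0 ≤ ∑ i ∈ Finset.range n, X i ω ^ q :=
    fun ω => Finset.sum_nonneg fun i _ => Real.rpow_nonneg (hXnn i ω) _
  have hsub : {ω | (n:ℝ) ^ θ < ∑ i ∈ Finset.range n, X i ω ^ p} ⊆
      {ω | (n:ℝ) ^ (θ * q / p) ≤ ∑ i ∈ Finset.range n, X i ω ^ q} := by
    intro ω hω
    simp only [Set.mem_ofPred_eq] at hω ⊢
    have h2 := sum_rpow_le_sum_rpow (Finset.range n) (fun i => X i ω ^ q)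
      (fun i => Real.rpow_nonneg (hXnn i ω) _) hr
    have h3 : ∀ i, (X i ω ^ q) ^ (p / q) = X i ω ^ p := fun i => by
      rw [← Real.rpow_mul (hXnn i ω)]; congr 1; field_simp
    simp only [h3] at h2
    have h4 := hω.le.trans h2
    have h5 := Real.rpow_le_rpow (by positivity) h4 (div_pos hq0 hp0).le
    rw [← Real.rpow_mul hn'.le, ← Real.rpow_mul (hT0 ω)] at h5
    have e1 : p / q * (q / p) = 1 := by field_simp
    rwa [e1, Real.rpow_one, ← mul_div_assoc] at h5
  have hmk := mul_meas_ge_le_integral_of_nonneg (μ := μ) (ae_of_all _ hT0)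
    (integrable_finsetSum _ fun i _ => (hB i).1) ((n:ℝ) ^ (θ * q / p))
  rw [integral_finsetSum _ fun i _ => (hB i).1] at hmk
  have hs : ∑ i ∈ Finset.range n, ∫ ω, X i ω ^ q ∂μ ≤ n * B := by
    have := Finset.sum_le_sum (s := Finset.range n) fun i _ => (hB i).2
    simpa using this
  have hfin := hmk.trans hs
  refine (measureReal_mono hsub).trans ?_
  rw [Real.rpow_sub hn', Real.rpow_one, ← mul_div_assoc, le_div_iff₀ (by positivity)]
  have : μ.real {ω | (n:ℝ) ^ (θ * q / p) ≤ ∑ i ∈ Finset.range n, X i ω ^ q} =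
    (μ {ω | (n:ℝ) ^ (θ * q / p) ≤ ∑ i ∈ Finset.range n, X i ω ^ q}).toReal := rfl
  simp only [Measure.real] at *
  linarith

lemma cheb {Ω : Type*} [MeasurableSpace Ω] (μ : Measure Ω) [IsProbabilityMeasure μ]
    (X : ℕ → Ω → ℝ) (hXmeas : ∀ i, Measurable (X i)) (hXnn : ∀ i ω, 0 ≤ X i ω)
    (v : ℕ → ℝ) (hvpos : ∀ n, 0 < v n) (p : ℝ) (hp : 0 < p) (n : ℕ) (L : ℝ) (hL : 0 < L)
    (hm : n * L ≤ ∑ i ∈ Finset.range n, ∫ ω, trunc (X i) (v n) ω ^ p ∂μ) (hn : 0 < n) :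
    μ.real {ω | ∑ i ∈ Finset.range n, X i ω ^ p < n * L / 2} ≤
      4 * v n ^ p / (n * L) + 4 * |covSum μ X v p n| / (n * L) ^ 2 := by
  have hn' : (0:ℝ) < n := by exact_mod_cast hn
  set Y : ℕ → Ω → ℝ := fun i ω => trunc (X i) (v n) ω ^ p with hY
  have hv0 : 0 ≤ v n ^ p := (Real.rpow_pos_of_pos (hvpos n) p).le
  have ht0 : ∀ i ω, 0 ≤ trunc (X i) (v n) ω := fun i ω => by
    unfold trunc; split_ifs; exacts [hXnn i ω, le_rfl]
  have hY0 : ∀ i ω, 0 ≤ Y i ω := fun i ω => Real.rpow_nonneg (ht0 i ω) _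
  have hYv : ∀ i ω, Y i ω ≤ v n ^ p := fun i ω => by
    refine Real.rpow_le_rpow (ht0 i ω) ?_ hp.le
    unfold trunc; split_ifs with h; exacts [h.le, (hvpos n).le]
  have hYX : ∀ i ω, Y i ω ≤ X i ω ^ p := fun i ω => by
    refine Real.rpow_le_rpow (ht0 i ω) ?_ hp.le
    unfold trunc; split_ifs with h; exacts [le_rfl, hXnn i ω]
  have hYm : ∀ i, Measurable (Y i) := fun i => by
    refine Measurable.pow_const ?_ p
    unfold trunc
    exact Measurable.ite (measurableSet_lt (hXmeas i) measurable_const) (hXmeas i) measurable_const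
  have hYL : ∀ i, MemLp (Y i) 2 μ := fun i =>
    MemLp.of_bound (hYm i).aestronglyMeasurable (v n ^ p) (ae_of_all _ fun ω => by
      rw [Real.norm_of_nonneg (hY0 i ω)]; exact hYv i ω)
  have hYi : ∀ i, Integrable (Y i) μ := fun i => (hYL i).integrable (by norm_num)
  set m := ∑ i ∈ Finset.range n, ∫ ω, Y i ω ∂μ with hmdef
  have hmpos : 0 < m := lt_of_lt_of_le (by positivity) hm
  have hvar : ProbabilityTheory.variance (∑ i ∈ Finset.range n, Y i) μ ≤
      v n ^ p * m + covSum μ X v p n := by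
    rw [ProbabilityTheory.variance_sum' fun i _ => hYL i]
    have : v n ^ p * m + covSum μ X v p n = ∑ i ∈ Finset.range n, ∑ j ∈ Finset.range n,
        ((if i = j then v n ^ p * ∫ ω, Y i ω ∂μ else 0) +
          if i = j then 0 else cov μ (Y i) (Y j)) := by
      simp only [Finset.sum_add_distrib]
      congr 1
      rw [hmdef, Finset.mul_sum]
      refine Finset.sum_congr rfl fun i hi => ?_
      rw [Finset.sum_ite_eq, if_pos hi]
    rw [this]
    refine Finset.sum_le_sum fun i _ => Finset.sum_le_sum fun j _ => ?_
    rw [ProbabilityTheory.covariance_eq_sub (hYL i) (hYL j)]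
    by_cases hij : i = j
    · subst hij
      simp only [if_true, add_zero]
      have h1 : ∫ ω, (Y i * Y i) ω ∂μ ≤ v n ^ p * ∫ ω, Y i ω ∂μ := by
        rw [← integral_const_mul]
        refine integral_mono ?_ ((hYi i).const_mul _) fun ω => ?_
        · exact (hYL i).integrable_mul (hYL i)
        · exact mul_le_mul_of_nonneg_right (hYv i ω) (hY0 i ω)
      nlinarith [sq_nonneg (∫ ω, Y i ω ∂μ)]
    · simp only [hij, if_false, zero_add]
      exact le_rfl
  have hsub : {ω | ∑ i ∈ Finset.range n, X i ω ^ p < n * L / 2} ⊆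
      {ω | m / 2 ≤ |(∑ i ∈ Finset.range n, Y i) ω - ∫ ω, (∑ i ∈ Finset.range n, Y i) ω ∂μ|} := by
    intro ω hω
    simp only [Set.mem_ofPred_eq, Finset.sum_apply] at hω ⊢
    rw [integral_finsetSum _ fun i _ => hYi i, abs_sub_comm]
    refine le_trans ?_ (le_abs_self _)
    have := Finset.sum_le_sum (s := Finset.range n) fun i _ => hYX i ω
    linarith
  have hch := ProbabilityTheory.meas_ge_le_variance_div_sq
    (memLp_finsetSum' (Finset.range n) fun i _ => hYL i) (half_pos hmpos)
  have h3 : μ.real {ω | ∑ i ∈ Finset.range n, X i ω ^ p < n * L / 2} ≤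
      ProbabilityTheory.variance (∑ i ∈ Finset.range n, Y i) μ / (m / 2) ^ 2 := by
    refine (measureReal_mono hsub).trans ?_
    exact ENNReal.toReal_le_of_le_ofReal
      (div_nonneg (ProbabilityTheory.variance_nonneg _ _) (by positivity)) hch
  refine h3.trans ?_
  calc _ ≤ (v n ^ p * m + |covSum μ X v p n|) / (m / 2) ^ 2 := by
        gcongr; exact hvar.trans (by gcongr; exact le_abs_self _)
    _ = 4 * v n ^ p / m + 4 * |covSum μ X v p n| / m ^ 2 := by field_simp; ring
    _ ≤ _ := by gcongr

lemma mean_lower {Ω : Type*} [MeasurableSpace Ω] (μ : Measure Ω) [IsProbabilityMeasure μ]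
    (X : Ω → ℝ) (hXmeas : Measurable X) (hXnn : ∀ ω, 0 ≤ X ω)
    (G : ℝ → ℝ) (hsurv : ∀ x : ℝ, 0 < x → (μ {ω | x < X ω}).toReal = G x)
    (v p : ℝ) (hv : 0 < v) (hp : 0 < p) :
    (v / 4) ^ p * (G (v / 4) - G (v / 2)) ≤ ∫ ω, trunc X v ω ^ p ∂μ := by
  set A := {ω | v / 4 < X ω} \ {ω | v / 2 < X ω} with hA
  have hmA1 : MeasurableSet {ω | v / 4 < X ω} := measurableSet_lt measurable_const hXmeas
  have hmA2 : MeasurableSet {ω | v / 2 < X ω} := measurableSet_lt measurable_const hXmeas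
  have hmA : MeasurableSet A := hmA1.diff hmA2
  have hμA : μ.real A = G (v / 4) - G (v / 2) := by
    have hss : {ω | v / 2 < X ω} ⊆ {ω | v / 4 < X ω} := by
      intro ω h
      simp only [Set.mem_ofPred_eq] at h ⊢
      linarith
    rw [hA, measureReal_sdiff hss hmA2,
      ← hsurv _ (by positivity), ← hsurv _ (by positivity)]; rfl
  have ht0 : ∀ ω, 0 ≤ trunc X v ω := fun ω => by
    unfold trunc; split_ifs; exacts [hXnn ω, le_rfl]
  have hYv : ∀ ω, trunc X v ω ^ p ≤ v ^ p := fun ω => by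
    refine Real.rpow_le_rpow (ht0 ω) ?_ hp.le
    unfold trunc; split_ifs with h; exacts [h.le, hv.le]
  have hYm : Measurable (fun ω => trunc X v ω ^ p) := by
    refine Measurable.pow_const ?_ p
    unfold trunc
    exact Measurable.ite (measurableSet_lt hXmeas measurable_const) hXmeas measurable_const
  have hYi : Integrable (fun ω => trunc X v ω ^ p) μ :=
    Integrable.of_bound hYm.aestronglyMeasurable (v ^ p) (ae_of_all _ fun ω => by
      rw [Real.norm_of_nonneg (Real.rpow_nonneg (ht0 ω) _)]; exact hYv ω)
  have h1 : ∫ ω, A.indicator (fun _ => (v / 4) ^ p) ω ∂μ = (v / 4) ^ p * (G (v / 4) - G (v / 2)) := by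
    rw [integral_indicator hmA, setIntegral_const, hμA, smul_eq_mul, mul_comm]
  rw [← h1]
  refine integral_mono ((integrable_const _).indicator hmA) hYi fun ω => ?_
  by_cases h : ω ∈ A
  · rw [Set.indicator_of_mem h]
    obtain ⟨ha, hb⟩ := h
    simp only [Set.mem_ofPred_eq, not_lt] at ha hb
    have : trunc X v ω = X ω := by unfold trunc; rw [if_pos (by linarith)]
    simp only [this]
    exact Real.rpow_le_rpow (by positivity) ha.le hp.le
  · rw [Set.indicator_of_notMem h]
    exact Real.rpow_nonneg (ht0 ω) _

lemma lower_whp {Ω : Type*} [MeasurableSpace Ω] (μ : Measure Ω) [IsProbabilityMeasure μ]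
    (X : ℕ → Ω → ℝ) (hXmeas : ∀ i, Measurable (X i)) (hXnn : ∀ i ω, 0 ≤ X i ω)
    (G : ℝ → ℝ) (hsurv : ∀ i, ∀ x : ℝ, 0 < x → (μ {ω | x < X i ω}).toReal = G x)
    (hpos : ∀ x, 0 < x → 0 < G x)
    (hanti : ∀ x y, 0 < x → x ≤ y → G y ≤ G x) (α : ℝ) (hα : 0 < α)
    (hG : ∀ lam : ℝ, 0 < lam →
      Tendsto (fun x => G (lam * x) / G x) atTop (nhds (lam ^ (-α))))
    (c : ℕ → ℝ) (hc : ∀ n, 0 < c n) (hctop : Tendsto c atTop atTop)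
    (hclog : Tendsto (fun n : ℕ => Real.log (c n) / Real.log n) atTop (nhds 0))
    (v : ℕ → ℝ) (hvpos : ∀ n, 0 < v n)
    (hv : Tendsto (fun n : ℕ => (n : ℝ) * G (v n) / c n) atTop (nhds 1))
    (p : ℝ) (hp : 0 < p) (hA : ConditionA μ X v c p) (θ : ℝ) (hθ0 : 0 < θ) (hθ : θ < p / α) :
    Tendsto (fun n : ℕ => μ.real {ω | ∑ i ∈ Finset.range n, X i ω ^ p < (n:ℝ) ^ θ})
      atTop (nhds 0) := by
  have hcpow : ∀ η : ℝ, 0 < η → ∀ᶠ n : ℕ in atTop, c n ≤ (n:ℝ) ^ η := by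
    intro η hη
    filter_upwards [hclog.eventually_lt_const hη, eventually_gt_atTop 1] with n h1 h2
    have h2' : (1:ℝ) < n := by exact_mod_cast h2
    rw [div_lt_iff₀ (Real.log_pos h2')] at h1
    rw [← Real.log_le_log_iff (hc n) (by positivity), Real.log_rpow (by positivity)]
    exact h1.le
  -- v tends to infinity
  have hGv : ∀ᶠ n : ℕ in atTop, G (v n) ≤ 2 * c n / n ∧ c n / 2 ≤ n * G (v n) := by
    filter_upwards [hv.eventually_lt_const (show (1:ℝ) < 2 by norm_num),
      hv.eventually_const_lt (show (1/2:ℝ) < 1 by norm_num), eventually_gt_atTop 0] with n h1 h2 h3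
    have h3' : (0:ℝ) < n := by exact_mod_cast h3
    rw [div_lt_iff₀ (hc n)] at h1
    rw [lt_div_iff₀ (hc n)] at h2
    rw [le_div_iff₀ h3']
    constructor <;> linarith
  have hGv0 : Tendsto (fun n => 2 * c n / (n:ℝ)) atTop (nhds 0) := by
    have h1 : Tendsto (fun n : ℕ => 2 * (n:ℝ) ^ (-(1/2:ℝ))) atTop (nhds 0) := by
      have := (tendsto_rpow_neg_atTop (y := 1/2) (by norm_num)).comp
        (tendsto_natCast_atTop_atTop (R := ℝ))
      simpa using this.const_mul 2
    refine squeeze_zero' (Eventually.of_forall fun n => by have := hc n; positivity) ?_ h1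
    filter_upwards [hcpow (1/2) (by norm_num), eventually_gt_atTop 0] with n h1 h3
    have h3' : (0:ℝ) < n := by exact_mod_cast h3
    rw [div_le_iff₀ h3', mul_assoc]
    gcongr
    refine h1.trans (le_of_eq ?_)
    nth_rewrite 3 [← Real.rpow_one (n:ℝ)]
    rw [← Real.rpow_add h3']; norm_num
  have hvtop : Tendsto v atTop atTop := by
    rw [tendsto_atTop]
    intro K
    set K' := max K 1
    have hK' : 0 < K' := lt_of_lt_of_le one_pos (le_max_right _ _)
    filter_upwards [hGv, hGv0.eventually_lt_const (hpos K' hK')] with n h1 h2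
    by_contra h
    push Not at h
    have := hanti (v n) K' (hvpos n) (h.le.trans (le_max_left _ _))
    linarith [h1.1]
  -- mean
  set κ0 : ℝ := ((4:ℝ) ^ α - 2 ^ α) / 2 with hκ0
  have hκ0pos : 0 < κ0 := by
    have : (2:ℝ) ^ α < 4 ^ α := Real.rpow_lt_rpow (by norm_num) (by norm_num) hα
    rw [hκ0]; linarith
  have hmean : ∀ᶠ n : ℕ in atTop, κ0 * G (v n) ≤ G (v n / 4) - G (v n / 2) := by
    have h4 := (hG (1/4) (by norm_num)).sub (hG (1/2) (by norm_num))
    have e : (1/4:ℝ) ^ (-α) - (1/2:ℝ) ^ (-α) = (4:ℝ) ^ α - 2 ^ α := by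
      rw [one_div, one_div, Real.inv_rpow (by norm_num), Real.inv_rpow (by norm_num),
        Real.rpow_neg (by norm_num), Real.rpow_neg (by norm_num), inv_inv, inv_inv]
    rw [e] at h4
    have h5 := (h4.comp hvtop).eventually_const_lt (show κ0 < (4:ℝ) ^ α - 2 ^ α by linarith)
    filter_upwards [h5] with n hn
    simp only [Function.comp] at hn
    rw [← sub_div, lt_div_iff₀ (hpos _ (hvpos n))] at hn
    rw [show v n / 4 = 1 / 4 * v n by ring, show v n / 2 = 1 / 2 * v n by ring]
    exact hn.le
  set κ : ℝ := (1/4:ℝ) ^ p * κ0 / 2 with hκ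
  have hκpos : 0 < κ := by positivity
  have hmain : Tendsto (fun n : ℕ => μ.real {ω | ∑ i ∈ Finset.range n, X i ω ^ p <
      κ * v n ^ p * c n / 2}) atTop (nhds 0) := by
    have hlim : Tendsto (fun n : ℕ => 4 / κ * (c n)⁻¹ + 4 / κ ^ 2 *
        |covSum μ X v p n / (v n ^ (2 * p) * c n ^ 2)|) atTop (nhds 0) := by
      have h1 := (hctop.inv_tendsto_atTop).const_mul (4 / κ)
      have h2 := (hA.abs).const_mul (4 / κ ^ 2)
      simpa using h1.add h2
    refine squeeze_zero' (Eventually.of_forall fun n => measureReal_nonneg) ?_ hlim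
    filter_upwards [hGv, hmean, eventually_gt_atTop 0] with n h1 h2 h3
    have h3' : (0:ℝ) < n := by exact_mod_cast h3
    have hvn := hvpos n
    have hcn := hc n
    have hvp : 0 < v n ^ p := by positivity
    have := cheb μ X hXmeas hXnn v hvpos p hp n (κ * v n ^ p * c n / n) (by positivity) ?_ h3
    · have e : (n:ℝ) * (κ * v n ^ p * c n / n) = κ * v n ^ p * c n := by field_simp
      rw [e] at this
      refine this.trans (le_of_eq ?_)
      have e2 : v n ^ (2 * p) = (v n ^ p) ^ 2 := by
        rw [mul_comm, Real.rpow_mul hvn.le]; norm_num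
      rw [e2, abs_div, abs_of_pos (show 0 < (v n ^ p) ^ 2 * c n ^ 2 by positivity)]
      field_simp
    · have e : (n:ℝ) * (κ * v n ^ p * c n / n) = κ * v n ^ p * c n := by field_simp
      rw [e]
      have hs : ∑ i ∈ Finset.range n, (v n / 4) ^ p * (G (v n / 4) - G (v n / 2)) ≤
          ∑ i ∈ Finset.range n, ∫ ω, trunc (X i) (v n) ω ^ p ∂μ :=
        Finset.sum_le_sum fun i _ => mean_lower μ (X i) (hXmeas i) (hXnn i) G (hsurv i) _ p hvn hp
      refine le_trans ?_ hs
      rw [Finset.sum_const, Finset.card_range, nsmul_eq_mul]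
      calc κ * v n ^ p * c n = ((1/4:ℝ) ^ p * v n ^ p * κ0) * (c n / 2) := by rw [hκ]; ring
        _ ≤ ((1/4:ℝ) ^ p * v n ^ p * κ0) * (n * G (v n)) := by gcongr; exact h1.2
        _ = n * ((v n / 4) ^ p * (κ0 * G (v n))) := by
          rw [show v n / 4 = 1 / 4 * v n by ring, Real.mul_rpow (by norm_num) hvn.le]; ring
        _ ≤ _ := by gcongr
  -- powers
  have hb0 : α < p / θ := by
    rw [lt_div_iff₀ hα] at hθ; rw [lt_div_iff₀ hθ0]; linarith
  obtain ⟨b, hb1, hb2⟩ := exists_between hb0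
  have hbpos : 0 < b := hα.trans hb1
  obtain ⟨x0, K, hx0, hK, hGK⟩ := potter_lower G hpos hanti α (hG 2 (by norm_num)) b hbpos.le hb1
  have hs0 : b * θ / p < 1 := by
    rw [lt_div_iff₀ hθ0] at hb2; rw [div_lt_one hp]; exact hb2
  obtain ⟨s, hs1, hs2⟩ := exists_between hs0
  have hexp : θ < s * (p / b) := by
    rw [div_lt_iff₀ hp] at hs1
    rw [← mul_div_assoc, lt_div_iff₀ hbpos]; linarith
  set D : ℝ := κ * (K / 2) ^ (p / b) / 2 with hD
  have hDpos : 0 < D := by positivity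
  have hbig : ∀ᶠ n : ℕ in atTop, 1 / D ≤ (n:ℝ) ^ (s * (p / b) - θ) :=
    ((tendsto_rpow_atTop (by linarith)).comp tendsto_natCast_atTop_atTop).eventually_ge_atTop _
  refine squeeze_zero' (Eventually.of_forall fun n => measureReal_nonneg) ?_ hmain
  filter_upwards [hGv, hbig, hcpow (1 - s) (by linarith), hvtop.eventually_ge_atTop x0,
    hctop.eventually_ge_atTop 1, eventually_gt_atTop 0] with n h1 h2 h3 h4 h5 h6
  refine measureReal_mono ?_
  intro ω hω
  simp only [Set.mem_ofPred_eq] at hω ⊢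
  refine hω.trans_le ?_
  have hn : (0:ℝ) < n := by exact_mod_cast h6
  have hvn := hvpos n
  have g1 : K * (v n) ^ (-b) ≤ 2 * (n:ℝ) ^ (-s) := by
    refine (hGK _ h4).trans (h1.1.trans ?_)
    rw [div_le_iff₀ hn, mul_assoc]
    gcongr
    refine h3.trans (le_of_eq ?_)
    nth_rewrite 3 [← Real.rpow_one (n:ℝ)]
    rw [← Real.rpow_add hn]; ring_nf
  have g2 : K / 2 * (n:ℝ) ^ s ≤ v n ^ b := by
    rw [Real.rpow_neg hvn.le, Real.rpow_neg hn.le, ← div_eq_mul_inv, ← div_eq_mul_inv,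
      div_le_div_iff₀ (by positivity) (by positivity)] at g1
    linarith
  have g3 : (K / 2) ^ (p / b) * (n:ℝ) ^ (s * (p / b)) ≤ v n ^ p := by
    have := Real.rpow_le_rpow (by positivity) g2 (show 0 ≤ p / b by positivity)
    rw [Real.mul_rpow (by positivity) (by positivity), ← Real.rpow_mul hn.le,
      ← Real.rpow_mul hvn.le, mul_div_cancel₀ _ hbpos.ne'] at this
    exact this
  calc (n:ℝ) ^ θ = (n:ℝ) ^ θ * D * (1 / D) := by field_simp
    _ ≤ (n:ℝ) ^ θ * D * (n:ℝ) ^ (s * (p / b) - θ) := by gcongr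
    _ = D * (n:ℝ) ^ (s * (p / b)) := by
      rw [mul_comm ((n:ℝ) ^ θ), mul_assoc, ← Real.rpow_add hn]; ring_nf
    _ = κ * ((K / 2) ^ (p / b) * (n:ℝ) ^ (s * (p / b))) * 1 / 2 := by rw [hD]; ring
    _ ≤ κ * v n ^ p * c n / 2 := by gcongr

lemma final_det (α : ℝ) (hα : 0 < α) (hα1 : α < 1) (ε : ℝ) (hε : 0 < ε) :
    ∃ δ : ℝ, 0 < δ ∧ δ < 1 / α ∧ ∀ᶠ n : ℕ in atTop, ∀ S1 S2 : ℝ,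
      (n:ℝ) ^ (1 / α - δ) ≤ S1 → S1 ≤ (n:ℝ) ^ (1 / α + δ) →
      (n:ℝ) ^ (2 / α - δ) ≤ S2 → S2 ≤ (n:ℝ) ^ (2 / α + δ) →
      |Real.log ((n:ℝ)⁻¹ * S2 - ((n:ℝ)⁻¹ * S1) ^ 2) / Real.log ((n:ℝ)⁻¹ * S1)
        - (2 - α) / (1 - α)| ≤ ε := by
  set A : ℝ := 2 / α - 1 with hA
  set B : ℝ := 1 / α - 1 with hB
  have hBpos : 0 < B := by
    have : 1 < 1 / α := by rw [lt_div_iff₀ hα]; linarith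
    linarith
  have hAB : (2 - α) / (1 - α) = A / B := by
    have : 1 - α ≠ 0 := by linarith
    rw [hA, hB]; field_simp
  have hcont : Tendsto (fun z : ℝ × ℝ => z.1 / z.2) (nhds (A, B)) (nhds (A / B)) :=
    (continuousAt_fst (p := (A, B))).div continuousAt_snd hBpos.ne'
  obtain ⟨d, hd, hdd⟩ := Metric.tendsto_nhds_nhds.1 hcont ε hε
  set δ : ℝ := min (d / 3) (min (1 / 8) (1 / (2 * α))) with hδ
  have hδpos : 0 < δ := by positivity
  have hδ1 : δ ≤ d / 3 := min_le_left _ _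
  have hδ2 : δ ≤ 1 / 8 := (min_le_right _ _).trans (min_le_left _ _)
  have hδ3 : δ ≤ 1 / (2 * α) := (min_le_right _ _).trans (min_le_right _ _)
  refine ⟨δ, hδpos, lt_of_le_of_lt hδ3 (by gcongr; linarith), ?_⟩
  have hbig : ∀ᶠ n : ℕ in atTop, 2 ≤ (n:ℝ) ^ δ :=
    ((tendsto_rpow_atTop hδpos).comp tendsto_natCast_atTop_atTop).eventually_ge_atTop _
  filter_upwards [hbig, eventually_gt_atTop 1] with n h2 h1 S1 S2 a1 a2 a3 a4
  have hn1 : (1:ℝ) < n := by exact_mod_cast h1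
  have hn : (0:ℝ) < n := by linarith
  have hlog : 0 < Real.log n := Real.log_pos hn1
  have hshift : ∀ t : ℝ, (n:ℝ)⁻¹ * (n:ℝ) ^ t = (n:ℝ) ^ (t - 1) := fun t => by
    rw [Real.rpow_sub hn, Real.rpow_one]; field_simp
  have b1 : (n:ℝ) ^ (B - δ) ≤ (n:ℝ)⁻¹ * S1 := by
    rw [show B - δ = (1 / α - δ) - 1 by rw [hB]; ring, ← hshift]; gcongr
  have b2 : (n:ℝ)⁻¹ * S1 ≤ (n:ℝ) ^ (B + δ) := by
    rw [show B + δ = (1 / α + δ) - 1 by rw [hB]; ring, ← hshift]; gcongr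
  have b3 : (n:ℝ) ^ (A - δ) ≤ (n:ℝ)⁻¹ * S2 := by
    rw [show A - δ = (2 / α - δ) - 1 by rw [hA]; ring, ← hshift]; gcongr
  have b4 : (n:ℝ)⁻¹ * S2 ≤ (n:ℝ) ^ (A + δ) := by
    rw [show A + δ = (2 / α + δ) - 1 by rw [hA]; ring, ← hshift]; gcongr
  set M1 := (n:ℝ)⁻¹ * S1
  set M2 := (n:ℝ)⁻¹ * S2
  have hM1 : 0 < M1 := lt_of_lt_of_le (by positivity) b1
  have hsq : M1 ^ 2 ≤ (n:ℝ) ^ (A - 2 * δ) := by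
    calc M1 ^ 2 ≤ ((n:ℝ) ^ (B + δ)) ^ 2 := by gcongr
      _ = (n:ℝ) ^ (2 * (B + δ)) := by
        rw [mul_comm, Real.rpow_mul hn.le]; norm_num
      _ ≤ _ := by
        apply Real.rpow_le_rpow_of_exponent_le hn1.le
        have : 2 / α = 2 * (1 / α) := by ring
        rw [hA, hB, this]; linarith
  have hVlow : (n:ℝ) ^ (A - 2 * δ) ≤ M2 - M1 ^ 2 := by
    have : 2 * (n:ℝ) ^ (A - 2 * δ) ≤ (n:ℝ) ^ (A - δ) := by
      rw [show A - δ = δ + (A - 2 * δ) by ring, Real.rpow_add hn]; gcongr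
    linarith
  have hVpos : 0 < M2 - M1 ^ 2 := lt_of_lt_of_le (by positivity) hVlow
  have hVup : M2 - M1 ^ 2 ≤ (n:ℝ) ^ (A + δ) := by nlinarith
  have l1 := Real.log_le_log (by positivity) b1
  have l2 := Real.log_le_log hM1 b2
  have l3 := Real.log_le_log (by positivity) hVlow
  have l4 := Real.log_le_log hVpos hVup
  rw [Real.log_rpow hn, ← le_div_iff₀ hlog] at l1 l3
  rw [Real.log_rpow hn, ← div_le_iff₀ hlog] at l2 l4
  have hdist : dist (Real.log (M2 - M1 ^ 2) / Real.log n, Real.log M1 / Real.log n) (A, B) < d := by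
    rw [Prod.dist_eq, max_lt_iff, Real.dist_eq, Real.dist_eq, abs_lt, abs_lt]
    refine ⟨⟨?_, ?_⟩, ?_, ?_⟩ <;> simp only <;> linarith
  have := hdd hdist
  simp only [Real.dist_eq] at this
  rw [div_div_div_cancel_right₀ hlog.ne'] at this
  rw [hAB]
  exact this.le

/-- **Corollary (classical Taylor's law).**
For `α ∈ (0,1)`, under Condition A(1) and Condition A(2), with `V_n = M_{n,2} − M_{n,1}²`
the sample variance, `log V_n / log M_{n,1} → (2−α)/(1−α)` in probability. -/
theorem taylors_law_variance
    {Ω : Type*} [MeasurableSpace Ω] (μ : Measure Ω) [IsProbabilityMeasure μ]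
    (X : ℕ → Ω → ℝ) (hXmeas : ∀ i, Measurable (X i)) (hXnn : ∀ i ω, 0 ≤ X i ω)
    (α : ℝ) (hα : 0 < α) (hα1 : α < 1)
    (l : ℝ → ℝ) (hlpos : ∀ x : ℝ, 0 < x → 0 < l x) (hl : SlowlyVarying l)
    (hsurv : ∀ i, ∀ x : ℝ, 0 < x → (μ {ω | x < X i ω}).toReal = x ^ (-α) * l x)
    (c : ℕ → ℝ) (hc : ∀ n, 0 < c n) (hctop : Tendsto c atTop atTop)
    (hncmono : Monotone fun n : ℕ => (n : ℝ) * c n)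
    (hnctop : Tendsto (fun n : ℕ => (n : ℝ) * c n) atTop atTop)
    (hclog : Tendsto (fun n : ℕ => Real.log (c n) / Real.log n) atTop (nhds 0))
    (v : ℕ → ℝ) (hvpos : ∀ n, 0 < v n)
    (hv : Tendsto (fun n : ℕ => (n : ℝ) * l (v n) / (v n ^ α * c n)) atTop (nhds 1))
    (hA1 : ConditionA μ X v c 1) (hA2 : ConditionA μ X v c 2) :
    TendstoInProbability μ
      (fun n ω =>
        Real.log (sampleMoment X 2 n ω - (sampleMoment X 1 n ω) ^ 2) /
          Real.log (sampleMoment X 1 n ω))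
      ((2 - α) / (1 - α)) := by
  set G : ℝ → ℝ := fun x => x ^ (-α) * l x with hGdef
  have hpos : ∀ x, 0 < x → 0 < G x := fun x hx => mul_pos (Real.rpow_pos_of_pos hx _) (hlpos x hx)
  have hanti : ∀ x y, 0 < x → x ≤ y → G y ≤ G x := by
    intro x y hx hxy
    have h1 := hsurv 0 x hx
    have h2 := hsurv 0 y (hx.trans_le hxy)
    simp only [hGdef]
    rw [← h1, ← h2]
    refine ENNReal.toReal_mono (measure_ne_top _ _) (measure_mono ?_)
    intro ω hω
    simp only [Set.mem_ofPred_eq] at hω ⊢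
    linarith
  have hG : ∀ lam : ℝ, 0 < lam →
      Tendsto (fun x => G (lam * x) / G x) atTop (nhds (lam ^ (-α))) := by
    intro lam hlam
    have h1 := (hl lam hlam).const_mul (lam ^ (-α))
    rw [mul_one] at h1
    refine h1.congr' ?_
    filter_upwards [eventually_gt_atTop 0] with x hx
    simp only [hGdef]
    rw [Real.mul_rpow hlam.le hx.le]
    have h2 := (Real.rpow_pos_of_pos hx (-α)).ne'
    have h3 := (hlpos x hx).ne'
    field_simp
  have hvG : Tendsto (fun n : ℕ => (n : ℝ) * G (v n) / c n) atTop (nhds 1) := by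
    refine hv.congr fun n => ?_
    simp only [hGdef]
    rw [Real.rpow_neg (hvpos n).le]
    have h2 := (Real.rpow_pos_of_pos (hvpos n) α).ne'
    have h3 := (hc n).ne'
    field_simp
  intro ε hε
  obtain ⟨δ, hδ, hδα, hdet⟩ := final_det α hα hα1 ε hε
  have h2α : 2 / α = 1 / α + 1 / α := by ring
  have hU : ∀ p : ℝ, α < p → ∀ θ, p / α < θ → _ := fun p hp θ hθ =>
    upper_whp μ X hXmeas hXnn G hsurv hpos hanti α hα (hG 2 (by norm_num)) p hp θ hθ
  have hLw : ∀ p : ℝ, 0 < p → ConditionA μ X v c p → ∀ θ, 0 < θ → θ < p / α → _ :=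
    fun p hp hA θ h0 hθ => lower_whp μ X hXmeas hXnn G hsurv hpos hanti α hα hG c hc hctop hclog
      v hvpos hvG p hp hA θ h0 hθ
  have t1 := hU 1 hα1 (1 / α + δ) (by linarith)
  have t2 := hU 2 (by linarith) (2 / α + δ) (by linarith)
  have t3 := hLw 1 one_pos hA1 (1 / α - δ) (by linarith) (by linarith)
  have t4 := hLw 2 two_pos hA2 (2 / α - δ) (by have := one_div_pos.2 hα; linarith) (by linarith)
  have ht := ((t1.add t2).add t3).add t4
  simp only [add_zero] at ht
  refine squeeze_zero' (Eventually.of_forall fun n => ENNReal.toReal_nonneg) ?_ ht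
  filter_upwards [hdet] with n hn
  refine le_trans ?_ ((measureReal_union_le _ _).trans (add_le_add_left
    ((measureReal_union_le _ _).trans (add_le_add_left (measureReal_union_le _ _) _)) _))
  refine ENNReal.toReal_mono (measure_ne_top _ _) (measure_mono ?_)
  intro ω hω
  by_contra hcon
  simp only [Set.mem_union, Set.mem_ofPred_eq, not_or, not_lt] at hcon hω
  obtain ⟨⟨⟨c1, c2⟩, c3⟩, c4⟩ := hcon
  have := hn _ _ c3 c1 c4 c2
  unfold sampleMoment at hω
  linarith
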